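/- arXiv:1705.08046 — 2 statements merged into one kernel-verified Lean document; each statement's English description precedes it below -/
import Mathlib

section
/- Let F : L²(Ω, ℝ) → ℝ be law-invariant and continuously Fréchet differentiable on an atomless probability space, and let ξ ∈ L²(Ω, ℝ). Then there exists a Borel measurable function g : ℝ → ℝ such that DF(ξ) = g(ξ) P-almost surely. -/
open MeasureTheory Filter Topology
open scoped ENNReal

section Atomless

variable {Ω : Type*} [MeasurableSpace Ω] {μ : Measure Ω} [IsFiniteMeasure μ]

/-- In an atomless finite measure space, sets of positive measure have subsets of arbitrarily
small positive measure. -/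
lemma exists_subset_measureReal_lt_of_atomless
    (hatomless : ∀ s : Set Ω, MeasurableSet s → 0 < μ s →
      ∃ t ⊆ s, MeasurableSet t ∧ 0 < μ t ∧ μ t < μ s)
    {s : Set Ω} (hs : MeasurableSet s) (hpos : 0 < μ.real s) {ε : ℝ} (hε : 0 < ε) :
    ∃ t ⊆ s, MeasurableSet t ∧ 0 < μ.real t ∧ μ.real t < ε := by
  have half : ∀ s : Set Ω, MeasurableSet s → 0 < μ.real s →
      ∃ t ⊆ s, MeasurableSet t ∧ 0 < μ.real t ∧ μ.real t ≤ μ.real s * (1 / 2) := by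
    intro s hs hpos
    obtain ⟨t, hts, ht, h0, h1⟩ := hatomless s hs (ENNReal.toReal_pos_iff.1 hpos).1
    have h0' : 0 < μ.real t := ENNReal.toReal_pos h0.ne' (measure_ne_top _ _)
    have h1' : μ.real t < μ.real s :=
      (ENNReal.toReal_lt_toReal (measure_ne_top _ _) (measure_ne_top _ _)).2 h1
    have hd : μ.real (s \ t) = μ.real s - μ.real t := measureReal_sdiff hts ht
    rcases le_total (μ.real t) (μ.real s * (1 / 2)) with h | h
    · exact ⟨t, hts, ht, h0', h⟩
    · exact ⟨s \ t, Set.sdiff_subset, hs.diff ht, by linarith, by linarith⟩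
  have iter : ∀ n : ℕ, ∃ t ⊆ s, MeasurableSet t ∧ 0 < μ.real t ∧
      μ.real t ≤ μ.real s * (1 / 2) ^ n := by
    intro n
    induction n with
    | zero => exact ⟨s, subset_rfl, hs, hpos, by simp⟩
    | succ n ih =>
      obtain ⟨t, hts, ht, h0, h1⟩ := ih
      obtain ⟨u, hut, hu, h2, h3⟩ := half t ht h0
      exact ⟨u, hut.trans hts, hu, h2, by rw [pow_succ]; linarith⟩
  obtain ⟨n, hn⟩ := exists_pow_lt_of_lt_one (div_pos hε hpos) (by norm_num : (1 / 2 : ℝ) < 1)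
  obtain ⟨t, hts, ht, h0, h1⟩ := iter n
  refine ⟨t, hts, ht, h0, h1.trans_lt ?_⟩
  rwa [lt_div_iff₀ hpos, mul_comm] at hn

/-- Sierpiński's theorem: an atomless finite measure takes all intermediate values. -/
lemma exists_subset_measureReal_eq_of_atomless
    (hatomless : ∀ s : Set Ω, MeasurableSet s → 0 < μ s →
      ∃ t ⊆ s, MeasurableSet t ∧ 0 < μ t ∧ μ t < μ s)
    {s : Set Ω} (hs : MeasurableSet s) {c : ℝ} (hc : 0 ≤ c) (hcs : c ≤ μ.real s) :
    ∃ t ⊆ s, MeasurableSet t ∧ μ.real t = c := by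
  let C : Type _ := {t : Set Ω // t ⊆ s ∧ MeasurableSet t ∧ μ.real t ≤ c}
  have step : ∀ (n : ℕ) (t : C), ∃ u : C, t.1 ⊆ u.1 ∧
      ∀ v : C, t.1 ⊆ v.1 → μ.real v.1 ≤ μ.real u.1 + 1 / ((n : ℝ) + 1) := by
    intro n t
    let S : Set ℝ := (fun v : C => μ.real v.1) '' {v | t.1 ⊆ v.1}
    have hne : S.Nonempty := ⟨_, t, Set.Subset.refl t.1, rfl⟩
    have hbdd : BddAbove S := ⟨c, by rintro _ ⟨v, -, rfl⟩; exact v.2.2.2⟩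
    obtain ⟨_, ⟨u, htu, rfl⟩, hu⟩ := exists_lt_of_lt_csSup hne
      (sub_lt_self (sSup S) (Nat.one_div_pos_of_nat (n := n) (α := ℝ)))
    refine ⟨u, htu, fun v hv => ?_⟩
    have := le_csSup hbdd ⟨v, hv, rfl⟩
    simp only at hu this
    linarith
  choose next hsub hnext using step
  let t : ℕ → C := fun n =>
    Nat.rec ⟨∅, Set.empty_subset _, MeasurableSet.empty, by simpa using hc⟩ next n
  have ht_succ : ∀ n, t (n + 1) = next n (t n) := fun n => rfl
  have hmono : Monotone fun n => (t n).1 :=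
    monotone_nat_of_le_succ fun n => by rw [ht_succ]; exact hsub n (t n)
  let T : Set Ω := ⋃ n, (t n).1
  have hTs : T ⊆ s := Set.iUnion_subset fun n => (t n).2.1
  have hT : MeasurableSet T := MeasurableSet.iUnion fun n => (t n).2.2.1
  have hTc : μ.real T ≤ c := by
    have h : Tendsto (fun n => μ.real (t n).1) atTop (𝓝 (μ.real T)) :=
      (ENNReal.tendsto_toReal (measure_ne_top μ T)).comp (tendsto_measure_iUnion_atTop hmono)
    exact le_of_tendsto' h fun n => (t n).2.2.2
  have hmax : ∀ v : C, T ⊆ v.1 → μ.real v.1 ≤ μ.real T := by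
    intro v hv
    have h : Tendsto (fun n : ℕ => μ.real T + 1 / ((n : ℝ) + 1)) atTop (𝓝 (μ.real T + 0)) :=
      tendsto_const_nhds.add tendsto_one_div_add_atTop_nhds_zero_nat
    rw [add_zero] at h
    refine ge_of_tendsto' h fun n => ?_
    refine (hnext n (t n) v ((Set.subset_iUnion (fun n => (t n).1) n).trans hv)).trans ?_
    gcongr
    · exact measure_ne_top _ _
    · exact Set.subset_iUnion (fun n => (t n).1) (n + 1)
  refine ⟨T, hTs, hT, hTc.antisymm (not_lt.1 fun hlt => ?_)⟩
  have hd : μ.real (s \ T) = μ.real s - μ.real T := measureReal_sdiff hTs hT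
  obtain ⟨w, hws, hw, hw0, hwc⟩ := exists_subset_measureReal_lt_of_atomless hatomless
    (hs.diff hT) (by linarith) (sub_pos.2 hlt)
  have hu : μ.real (T ∪ w) = μ.real T + μ.real w :=
    measureReal_union (Set.disjoint_sdiff_right.mono_right hws) hw
  have := hmax ⟨T ∪ w, Set.union_subset hTs (hws.trans Set.sdiff_subset), hT.union hw,
    by linarith⟩ Set.subset_union_left
  simp only at this
  linarith

/-- On an atomless space, a function whose integral over subsets of `E` depends only on the
measure of the subset is a.e. constant on `E`. -/
lemma exists_ae_restrict_eq_const_of_setIntegral_eq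
    (hatomless : ∀ s : Set Ω, MeasurableSet s → 0 < μ s →
      ∃ t ⊆ s, MeasurableSet t ∧ 0 < μ t ∧ μ t < μ s)
    {h : Ω → ℝ} (hm : Measurable h) (hi : Integrable h μ) {E : Set Ω} (hE : MeasurableSet E)
    (heq : ∀ A ⊆ E, ∀ B ⊆ E, MeasurableSet A → MeasurableSet B → μ.real A = μ.real B →
      ∫ ω in A, h ω ∂μ = ∫ ω in B, h ω ∂μ) :
    ∃ c : ℝ, ∀ᵐ ω ∂μ.restrict E, h ω = c := by
  rcases eq_or_ne (μ E) 0 with h0 | h0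
  · exact ⟨0, by simp [Measure.restrict_eq_zero.2 h0]⟩
  have hEpos : 0 < μ.real E := ENNReal.toReal_pos h0 (measure_ne_top _ _)
  let c : ℝ := (∫ ω in E, h ω ∂μ) / μ.real E
  refine ⟨c, ?_⟩
  have hic : Integrable (fun ω => h ω - c) (μ.restrict E) :=
    hi.restrict.sub (integrable_const c)
  have hzero : ∫ ω in E, (h ω - c) ∂μ = 0 := by
    rw [integral_sub hi.restrict (integrable_const c), setIntegral_const, smul_eq_mul]
    simp only [c]
    field_simp
    simp
  let P : Set Ω := E ∩ {ω | c < h ω}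
  let N : Set Ω := E ∩ {ω | h ω < c}
  have hP : MeasurableSet P := hE.inter (measurableSet_lt measurable_const hm)
  have hN : MeasurableSet N := hE.inter (measurableSet_lt hm measurable_const)
  have key : μ.real P = 0 ∨ μ.real N = 0 := by
    by_contra! hcon
    have hPpos := measureReal_nonneg.lt_of_ne' hcon.1
    have hNpos := measureReal_nonneg.lt_of_ne' hcon.2
    let m := min (μ.real P) (μ.real N)
    have hm0 : 0 < m := lt_min hPpos hNpos
    obtain ⟨A, hAP, hA, hAm⟩ := exists_subset_measureReal_eq_of_atomless hatomless hP hm0.le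
      (min_le_left _ _)
    obtain ⟨B, hBN, hB, hBm⟩ := exists_subset_measureReal_eq_of_atomless hatomless hN hm0.le
      (min_le_right _ _)
    have hAB := heq A (hAP.trans Set.inter_subset_left) B (hBN.trans Set.inter_subset_left) hA hB
      (hAm.trans hBm.symm)
    have hA0 : 0 < ∫ ω in A, (h ω - c) ∂μ := by
      rw [setIntegral_pos_iff_support_of_nonneg_ae]
      · have : (Function.support fun ω => h ω - c) ∩ A = A :=
          Set.inter_eq_right.2 fun ω hω => (sub_pos.2 (hAP hω).2).ne'
        rw [this]
        exact (ENNReal.toReal_pos_iff.1 (hAm ▸ hm0 : 0 < μ.real A)).1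
      · exact (ae_restrict_iff' hA).2 (ae_of_all _ fun ω hω => (sub_pos.2 (hAP hω).2).le)
      · exact (hi.sub (integrable_const c)).integrableOn
    have hB0 : ∫ ω in B, (h ω - c) ∂μ ≤ 0 :=
      setIntegral_nonpos hB fun ω hω => (sub_neg.2 (hBN hω).2).le
    rw [integral_sub hi.restrict (integrable_const c), setIntegral_const, hAm] at hA0
    rw [integral_sub hi.restrict (integrable_const c), setIntegral_const, hBm] at hB0
    linarith
  rcases key with h1 | h1
  · have h2 : ∀ᵐ ω ∂μ.restrict E, h ω ≤ c := by
      rw [measureReal_eq_zero_iff] at h1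
      rw [ae_restrict_iff' hE]
      filter_upwards [measure_eq_zero_iff_ae_notMem.1 h1] with ω hω hωE
      exact not_lt.1 fun hlt => hω ⟨hωE, hlt⟩
    have h3 := (integral_eq_zero_iff_of_nonneg_ae (f := fun ω => -(h ω - c))
      (h2.mono fun ω hω => by simpa using hω) hic.neg).1 (by rw [integral_neg, hzero, neg_zero])
    filter_upwards [h3] with ω hω
    simp only [Pi.zero_apply] at hω
    linarith
  · have h2 : ∀ᵐ ω ∂μ.restrict E, c ≤ h ω := by
      rw [measureReal_eq_zero_iff] at h1
      rw [ae_restrict_iff' hE]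
      filter_upwards [measure_eq_zero_iff_ae_notMem.1 h1] with ω hω hωE
      exact not_lt.1 fun hlt => hω ⟨hωE, hlt⟩
    have h3 := (integral_eq_zero_iff_of_nonneg_ae
      (h2.mono fun ω hω => by simpa using hω) hic).1 hzero
    filter_upwards [h3] with ω hω
    simp only [Pi.zero_apply] at hω
    linarith

end Atomless

section LawInvariant

variable {Ω : Type*} [MeasurableSpace Ω] {μ : Measure Ω}

/-- The law of `f + ε • 1_A`, for `A` inside a set `E` on which `f` is a.e. constant. -/
lemma map_add_indicator_eq {f : Ω → ℝ} (hf : Measurable f) {E A : Set Ω}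
    (hE : MeasurableSet E) (hA : MeasurableSet A) (hAE : A ⊆ E) {a ε : ℝ}
    (hfa : ∀ᵐ ω ∂μ.restrict E, f ω = a) :
    Measure.map (fun ω => f ω + A.indicator (fun _ => ε) ω) μ =
      μ A • Measure.dirac (a + ε) + μ (E \ A) • Measure.dirac a +
        Measure.map f (μ.restrict Eᶜ) := by
  have hμ : μ = μ.restrict A + μ.restrict (E \ A) + μ.restrict Eᶜ := by
    rw [← Measure.restrict_union Set.disjoint_sdiff_right (hE.diff hA),
      Set.union_sdiff_cancel hAE, Measure.restrict_add_restrict_compl hE]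
  have hg : Measurable (fun ω => f ω + A.indicator (fun _ => ε) ω) :=
    hf.add (measurable_const.indicator hA)
  have h1 : Measure.map (fun ω => f ω + A.indicator (fun _ => ε) ω) (μ.restrict A) =
      μ A • Measure.dirac (a + ε) := by
    rw [Measure.map_congr (g := fun _ => a + ε), Measure.map_const, Measure.restrict_apply_univ]
    filter_upwards [ae_restrict_of_ae_restrict_of_subset hAE hfa, ae_restrict_mem hA]
      with ω h1 h2
    rw [h1, Set.indicator_of_mem h2]
  have h2 : Measure.map (fun ω => f ω + A.indicator (fun _ => ε) ω) (μ.restrict (E \ A)) =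
      μ (E \ A) • Measure.dirac a := by
    rw [Measure.map_congr (g := fun _ => a), Measure.map_const, Measure.restrict_apply_univ]
    filter_upwards [ae_restrict_of_ae_restrict_of_subset Set.sdiff_subset hfa,
      ae_restrict_mem (hE.diff hA)] with ω h1 h2
    rw [h1, Set.indicator_of_notMem h2.2, add_zero]
  have h3 : Measure.map (fun ω => f ω + A.indicator (fun _ => ε) ω) (μ.restrict Eᶜ) =
      Measure.map f (μ.restrict Eᶜ) := by
    refine Measure.map_congr ?_
    filter_upwards [ae_restrict_mem hE.compl] with ω h2
    rw [Set.indicator_of_notMem fun h => h2 (hAE h), add_zero]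
  rw [← h1, ← h2, ← h3]
  conv_lhs => rw [hμ]
  rw [Measure.map_add _ _ hg, Measure.map_add _ _ hg]

variable [IsProbabilityMeasure μ]

/-- The gradient of a law-invariant function at `ζ` is a.e. constant on sets where `ζ` is. -/
lemma exists_gradient_eq_const_of_law_invariant
    (hatomless : ∀ s : Set Ω, MeasurableSet s → 0 < μ s →
      ∃ t ⊆ s, MeasurableSet t ∧ 0 < μ t ∧ μ t < μ s)
    {F : Lp ℝ 2 μ → ℝ}
    (hlaw : ∀ ζ ζ' : Lp ℝ 2 μ, Measure.map (ζ : Ω → ℝ) μ = Measure.map (ζ' : Ω → ℝ) μ →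
      F ζ = F ζ')
    {ζ D : Lp ℝ 2 μ}
    (hdiff : ∀ η : Lp ℝ 2 μ,
      Tendsto (fun ε : ℝ => (F (ζ + ε • η) - F ζ) / ε) (𝓝[≠] 0)
        (𝓝 (∫ ω, D ω * η ω ∂μ)))
    {E : Set Ω} (hE : MeasurableSet E) {a : ℝ} (hζ : ∀ᵐ ω ∂μ.restrict E, ζ ω = a) :
    ∃ c : ℝ, ∀ᵐ ω ∂μ.restrict E, D ω = c := by
  refine exists_ae_restrict_eq_const_of_setIntegral_eq hatomless
    (Lp.stronglyMeasurable D).measurable ((Lp.memLp D).integrable (by norm_num)) hE ?_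
  intro A hAE B hBE hA hB hAB
  have hAB' : μ A = μ B :=
    (ENNReal.toReal_eq_toReal_iff' (measure_ne_top _ _) (measure_ne_top _ _)).1 hAB
  have hint : ∀ {A : Set Ω} (hA : MeasurableSet A),
      ∫ ω, D ω * indicatorConstLp 2 hA (measure_ne_top μ A) (1 : ℝ) ω ∂μ =
        ∫ ω in A, D ω ∂μ := by
    intro A hA
    rw [← integral_indicator hA]
    refine integral_congr_ae ?_
    filter_upwards [indicatorConstLp_coeFn (p := 2) (hs := hA) (hμs := measure_ne_top μ A)
      (c := (1 : ℝ))] with ω hω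
    rw [hω]
    by_cases h : ω ∈ A <;> simp [h]
  have hmap : ∀ {A : Set Ω} (hA : MeasurableSet A), A ⊆ E → ∀ ε : ℝ,
      Measure.map (ζ + ε • indicatorConstLp 2 hA (measure_ne_top μ A) (1 : ℝ) : Lp ℝ 2 μ) μ =
        μ A • Measure.dirac (a + ε) + μ (E \ A) • Measure.dirac a +
          Measure.map ζ (μ.restrict Eᶜ) := by
    intro A hA hAE ε
    rw [← map_add_indicator_eq (Lp.stronglyMeasurable ζ).measurable hE hA hAE hζ]
    refine Measure.map_congr ?_
    filter_upwards [indicatorConstLp_coeFn (p := 2) (hs := hA) (hμs := measure_ne_top μ A)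
      (c := (1 : ℝ)), Lp.coeFn_add ζ (ε • indicatorConstLp 2 hA (measure_ne_top μ A) (1 : ℝ)),
      Lp.coeFn_smul ε (indicatorConstLp 2 hA (measure_ne_top μ A) (1 : ℝ))] with ω h1 h2 h3
    rw [h2, Pi.add_apply, h3, Pi.smul_apply, h1]
    by_cases h : ω ∈ A <;> simp [h]
  rw [← hint hA, ← hint hB]
  refine tendsto_nhds_unique (hdiff _) ((hdiff _).congr fun ε => ?_)
  rw [hlaw _ _ ((hmap hB hBE ε).trans ((hmap hA hAE ε).trans ?_).symm)]
  rw [measure_sdiff hAE hA.nullMeasurableSet (measure_ne_top _ _),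
    measure_sdiff hBE hB.nullMeasurableSet (measure_ne_top _ _), hAB']

end LawInvariant

/-- A function in `L²` is the limit of its roundings to the grid `ℤ / (n + 1)`. -/
lemma exists_Lp_tendsto_floor_div {Ω : Type*} [MeasurableSpace Ω] {μ : Measure Ω}
    [IsProbabilityMeasure μ] (ξ : Lp ℝ 2 μ) :
    ∃ ζ : ℕ → Lp ℝ 2 μ, Tendsto ζ atTop (𝓝 ξ) ∧
      ∀ n : ℕ, ∀ᵐ ω ∂μ, ζ n ω = (⌊((n : ℝ) + 1) * ξ ω⌋ : ℝ) / ((n : ℝ) + 1) := by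
  have hξ : Measurable ξ := (Lp.stronglyMeasurable ξ).measurable
  have hbound : ∀ (n : ℕ) (x : ℝ),
      |(⌊((n : ℝ) + 1) * x⌋ : ℝ) / ((n : ℝ) + 1) - x| ≤ 1 / ((n : ℝ) + 1) := by
    intro n x
    have hn : (0 : ℝ) < (n : ℝ) + 1 := n.cast_add_one_pos
    have h1 := Int.floor_le (((n : ℝ) + 1) * x)
    have h2 := Int.lt_floor_add_one (((n : ℝ) + 1) * x)
    rw [div_sub' hn.ne', abs_div, abs_of_pos hn]
    gcongr
    rw [abs_le]
    constructor <;> linarith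
  have hmeas : ∀ n : ℕ,
      Measurable fun ω => (⌊((n : ℝ) + 1) * ξ ω⌋ : ℝ) / ((n : ℝ) + 1) - ξ ω := by
    intro n
    fun_prop
  have hmem : ∀ n : ℕ,
      MemLp (fun ω => (⌊((n : ℝ) + 1) * ξ ω⌋ : ℝ) / ((n : ℝ) + 1) - ξ ω) 2 μ := fun n =>
    MemLp.of_bound (hmeas n).aestronglyMeasurable (1 / ((n : ℝ) + 1))
      (ae_of_all _ fun ω => hbound n (ξ ω))
  refine ⟨fun n => (hmem n).toLp _ + ξ, ?_, fun n => ?_⟩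
  · have h0 : Tendsto (fun n => (hmem n).toLp _) atTop (𝓝 0) := by
      refine squeeze_zero_norm (fun n => ?_) tendsto_one_div_add_atTop_nhds_zero_nat
      have := Lp.norm_le_of_ae_bound (f := (hmem n).toLp _) (C := 1 / ((n : ℝ) + 1))
        (by positivity) ((hmem n).coeFn_toLp.mono fun ω hω => by rw [hω]; exact hbound n (ξ ω))
      simpa [measureUnivNNReal] using this
    simpa using h0.add_const ξ
  · filter_upwards [(hmem n).coeFn_toLp, Lp.coeFn_add ((hmem n).toLp _) ξ] with ω h1 h2
    rw [h2, Pi.add_apply, h1, sub_add_cancel]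

/-- Structure of Wasserstein derivatives: if `F : L² → ℝ` is law invariant and continuously
Fréchet differentiable on an atomless probability space, then `DF(ξ) = g(ξ)` a.s. for some
Borel function `g`. -/
theorem wasserstein_derivative_structure
    {Ω : Type*} [MeasurableSpace Ω] (μ : Measure Ω) [IsProbabilityMeasure μ]
    (hatomless : ∀ s : Set Ω, MeasurableSet s → 0 < μ s →
      ∃ t ⊆ s, MeasurableSet t ∧ 0 < μ t ∧ μ t < μ s)
    (F : Lp ℝ 2 μ → ℝ)
    (hlaw : ∀ ζ ζ' : Lp ℝ 2 μ, Measure.map (ζ : Ω → ℝ) μ = Measure.map (ζ' : Ω → ℝ) μ →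
      F ζ = F ζ')
    (DF : Lp ℝ 2 μ → Lp ℝ 2 μ)
    (hdiff : ∀ ζ η : Lp ℝ 2 μ,
      Tendsto (fun ε : ℝ => (F (ζ + ε • η) - F ζ) / ε) (𝓝[≠] 0)
        (𝓝 (∫ ω, DF ζ ω * η ω ∂μ)))
    (hcont : Continuous DF)
    (ξ : Lp ℝ 2 μ) :
    ∃ g : ℝ → ℝ, Measurable g ∧ ∀ᵐ ω ∂μ, DF ξ ω = g (ξ ω) := by
  have hξ : Measurable ξ := (Lp.stronglyMeasurable ξ).measurable
  obtain ⟨ζ, hζ, hζe⟩ := exists_Lp_tendsto_floor_div ξ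
  have hE : ∀ (n : ℕ) (k : ℤ), MeasurableSet {ω | ⌊((n : ℝ) + 1) * ξ ω⌋ = k} := fun n k =>
    (hξ.const_mul _).floor (measurableSet_singleton k)
  have hconst : ∀ (n : ℕ) (k : ℤ), ∃ c : ℝ,
      ∀ᵐ ω ∂μ.restrict {ω | ⌊((n : ℝ) + 1) * ξ ω⌋ = k}, DF (ζ n) ω = c := by
    intro n k
    refine exists_gradient_eq_const_of_law_invariant hatomless hlaw (hdiff (ζ n)) (hE n k)
      (a := k / ((n : ℝ) + 1)) ?_
    filter_upwards [ae_restrict_of_ae (hζe n), ae_restrict_mem (hE n k)] with ω h1 h2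
    rw [h1, h2]
  choose c hc using hconst
  let G : ℕ → ℝ → ℝ := fun n x => c n ⌊((n : ℝ) + 1) * x⌋
  have hG : ∀ n, Measurable (G n) := fun n =>
    (measurable_from_top (f := c n)).comp (measurable_id.const_mul _).floor
  have hGae : ∀ᵐ ω ∂μ, ∀ n, DF (ζ n) ω = G n (ξ ω) := by
    refine ae_all_iff.2 fun n => ?_
    have : ∀ᵐ ω ∂μ, ∀ k : ℤ, ⌊((n : ℝ) + 1) * ξ ω⌋ = k → DF (ζ n) ω = c n k :=
      ae_all_iff.2 fun k => (ae_restrict_iff' (hE n k)).1 (hc n k)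
    filter_upwards [this] with ω hω
    exact hω _ rfl
  obtain ⟨φ, -, hφ⟩ := (tendstoInMeasure_of_tendsto_Lp
    ((hcont.tendsto ξ).comp hζ)).exists_seq_tendsto_ae
  refine ⟨fun x => limsup (fun i => G (φ i) x) atTop, Measurable.limsup fun i => hG (φ i), ?_⟩
  filter_upwards [hGae, hφ] with ω h1 h2
  refine (Tendsto.limsup_eq (h2.congr fun i => ?_)).symm
  exact h1 (φ i)
end

section
/- Let F : L²(Ω, ℝ) → ℝ be law-invariant and continuously Fréchet differentiable on an atomless probability space. Then the function g in the representation DF(ξ) = g(ξ) depends only on the law of ξ: if ξ and ξ' have the same law, then the same function g satisfies DF(ξ) = g(ξ) a.s. and DF(ξ') = g(ξ') a.s. -/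
open MeasureTheory Filter Topology
open scoped ENNReal

section Atomless

variable {Ω : Type*} [MeasurableSpace Ω] {μ : Measure Ω} [IsFiniteMeasure μ]

/-- An atomless finite measure charges sets of arbitrarily small measure. -/
lemma exists_subset_measureReal_le
    (hatomless : ∀ s : Set Ω, MeasurableSet s → 0 < μ s →
      ∃ t ⊆ s, MeasurableSet t ∧ 0 < μ t ∧ μ t < μ s)
    {s : Set Ω} (hs : MeasurableSet s) (hpos : 0 < μ.real s) {ε : ℝ} (hε : 0 < ε) :
    ∃ t ⊆ s, MeasurableSet t ∧ 0 < μ.real t ∧ μ.real t ≤ ε := by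
  have halve : ∀ u : Set Ω, MeasurableSet u → 0 < μ.real u →
      ∃ t ⊆ u, MeasurableSet t ∧ 0 < μ.real t ∧ μ.real t ≤ μ.real u / 2 := by
    intro u hu hu0
    obtain ⟨t, htu, ht, ht0, htlt⟩ := hatomless u hu (ENNReal.toReal_pos_iff.1 hu0).1
    have hlt : μ.real t < μ.real u :=
      (ENNReal.toReal_lt_toReal (measure_ne_top _ _) (measure_ne_top _ _)).2 htlt
    have hdiff := measureReal_sdiff (μ := μ) htu ht
    rcases le_total (μ.real t) (μ.real u / 2) with h | h
    · exact ⟨t, htu, ht, ENNReal.toReal_pos ht0.ne' (measure_ne_top _ _), h⟩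
    · exact ⟨u \ t, Set.sdiff_subset, hu.diff ht, by linarith, by linarith⟩
  have iter : ∀ n : ℕ, ∃ t ⊆ s, MeasurableSet t ∧ 0 < μ.real t ∧
      μ.real t ≤ μ.real s * (1 / 2) ^ n := by
    intro n
    induction n with
    | zero => exact ⟨s, subset_rfl, hs, hpos, by simp⟩
    | succ n ih =>
      obtain ⟨t, hts, ht, ht0, htle⟩ := ih
      obtain ⟨v, hvt, hv, hv0, hvle⟩ := halve t ht ht0
      exact ⟨v, hvt.trans hts, hv, hv0, by rw [pow_succ]; linarith⟩
  obtain ⟨n, hn⟩ := exists_pow_lt_of_lt_one (div_pos hε hpos) (by norm_num : (1 / 2 : ℝ) < 1)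
  obtain ⟨t, hts, ht, ht0, htle⟩ := iter n
  refine ⟨t, hts, ht, ht0, htle.trans ?_⟩
  rw [lt_div_iff₀ hpos] at hn
  linarith

/-- **Sierpiński's theorem**: an atomless finite measure takes every intermediate value. -/
lemma exists_subset_measureReal_eq
    (hatomless : ∀ s : Set Ω, MeasurableSet s → 0 < μ s →
      ∃ t ⊆ s, MeasurableSet t ∧ 0 < μ t ∧ μ t < μ s)
    {s : Set Ω} (hs : MeasurableSet s) {a : ℝ} (ha : 0 ≤ a) (has : a ≤ μ.real s) :
    ∃ t ⊆ s, MeasurableSet t ∧ μ.real t = a := by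
  let P : Set Ω → Prop := fun t ↦ t ⊆ s ∧ MeasurableSet t ∧ μ.real t ≤ a
  have step : ∀ (n : ℕ) (t : Subtype P), ∃ t' : Subtype P, t.1 ⊆ t'.1 ∧
      ∀ u, P u → t.1 ⊆ u → μ.real u ≤ μ.real t'.1 + 1 / (n + 1) := by
    rintro n ⟨t, ht⟩
    let V : Set ℝ := μ.real '' {u | P u ∧ t ⊆ u}
    have hV : BddAbove V := ⟨a, by rintro _ ⟨u, hu, rfl⟩; exact hu.1.2.2⟩
    have hVne : V.Nonempty := ⟨_, t, ⟨ht, subset_rfl⟩, rfl⟩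
    obtain ⟨_, ⟨t', ht', rfl⟩, hlt⟩ := exists_lt_of_lt_csSup hVne
      (sub_lt_self (sSup V) (Nat.one_div_pos_of_nat (n := n) (α := ℝ)))
    refine ⟨⟨t', ht'.1⟩, ht'.2, fun u hu htu ↦ ?_⟩
    have := le_csSup hV ⟨u, ⟨hu, htu⟩, rfl⟩
    simp only at *
    linarith
  choose next hnext hmax using step
  let T : ℕ → Subtype P := fun n ↦
    Nat.rec ⟨∅, Set.empty_subset _, MeasurableSet.empty, by simpa using ha⟩ next n
  have hmono : Monotone fun n ↦ (T n).1 := monotone_nat_of_le_succ fun n ↦ hnext n (T n)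
  let U := ⋃ n, (T n).1
  have hUm : MeasurableSet U := .iUnion fun n ↦ (T n).2.2.1
  have hUa : μ.real U ≤ a :=
    le_of_tendsto ((ENNReal.tendsto_toReal (measure_ne_top _ _)).comp
      (tendsto_measure_iUnion_atTop hmono)) (.of_forall fun n ↦ (T n).2.2.2)
  have hUs : U ⊆ s := Set.iUnion_subset fun n ↦ (T n).2.1
  refine ⟨U, hUs, hUm, hUa.antisymm (not_lt.1 fun hlt ↦ ?_)⟩
  obtain ⟨B, hBs, hB, hB0, hBle⟩ := exists_subset_measureReal_le hatomless (hs.diff hUm)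
    (by rw [measureReal_sdiff hUs hUm]; linarith) (sub_pos.2 hlt)
  have hUB : μ.real (U ∪ B) = μ.real U + μ.real B :=
    measureReal_union (Set.disjoint_left.2 fun x hx hxB ↦ (hBs hxB).2 hx) hB
  have hPUB : P (U ∪ B) :=
    ⟨Set.union_subset hUs (hBs.trans Set.sdiff_subset), hUm.union hB, by linarith⟩
  obtain ⟨n, hn⟩ := exists_nat_one_div_lt hB0
  have h1 := hmax n (T n) _ hPUB ((Set.subset_iUnion (fun n ↦ (T n).1) n).trans
    Set.subset_union_left)
  have h2 : μ.real (next n (T n)).1 ≤ μ.real U :=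
    measureReal_mono (Set.subset_iUnion (fun n ↦ (T n).1) (n + 1))
  linarith

/-- If two functions have the same integral over subsets of equal measure of `E` and `E'`, then
the first is bounded above on `E` by the average of the second on `E'`. -/
lemma ae_le_setAverage_of_setIntegral_eq
    (hatomless : ∀ s : Set Ω, MeasurableSet s → 0 < μ s →
      ∃ t ⊆ s, MeasurableSet t ∧ 0 < μ t ∧ μ t < μ s)
    {f f' : Ω → ℝ} (hfm : Measurable f) (hfm' : Measurable f')
    (hf : Integrable f μ) (hf' : Integrable f' μ)
    {E E' : Set Ω} (hE : MeasurableSet E) (hE' : MeasurableSet E') (hEE' : μ E = μ E')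
    (h : ∀ A ⊆ E, ∀ A' ⊆ E', MeasurableSet A → MeasurableSet A' → μ A = μ A' →
      ∫ ω in A, f ω ∂μ = ∫ ω in A', f' ω ∂μ) :
    ∀ᵐ ω ∂μ, ω ∈ E → f ω ≤ ⨍ x in E', f' x ∂μ := by
  set c := ⨍ x in E', f' x ∂μ
  by_contra hcon
  have hP : MeasurableSet (E ∩ {ω | c < f ω}) := hE.inter (measurableSet_lt measurable_const hfm)
  have hN : MeasurableSet (E' ∩ {ω | f' ω ≤ c}) :=
    hE'.inter (measurableSet_le hfm' measurable_const)
  have hP0 : μ (E ∩ {ω | c < f ω}) ≠ 0 := by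
    intro h0
    refine hcon ?_
    rw [ae_iff]
    convert h0 using 2
    ext ω
    simp
  have hE0 : μ E' ≠ 0 := by
    rw [← hEE']
    exact fun h0 ↦ hP0 (measure_mono_null Set.inter_subset_left h0)
  have hN0 : μ (E' ∩ {ω | f' ω ≤ c}) ≠ 0 :=
    (measure_le_setAverage_pos hE0 (measure_ne_top _ _) hf'.integrableOn).ne'
  have hPr := ENNReal.toReal_pos hP0 (measure_ne_top _ _)
  have hNr := ENNReal.toReal_pos hN0 (measure_ne_top _ _)
  obtain ⟨A, hAP, hA, hAm⟩ := exists_subset_measureReal_eq hatomless hP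
    (le_min hPr.le hNr.le) (min_le_left _ _)
  obtain ⟨A', hAN, hA', hAm'⟩ := exists_subset_measureReal_eq hatomless hN
    (le_min hPr.le hNr.le) (min_le_right _ _)
  have hA0 : 0 < μ.real A := hAm ▸ lt_min hPr hNr
  have hAA' : μ A = μ A' :=
    (measureReal_eq_measureReal_iff).1 (hAm.trans hAm'.symm)
  have heq := h A (hAP.trans Set.inter_subset_left) A' (hAN.trans Set.inter_subset_left) hA hA' hAA'
  have hle : ∫ ω in A', f' ω ∂μ ≤ c * μ.real A' := by
    have := setIntegral_mono_on hf'.integrableOn (integrable_const c).integrableOn hA'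
      fun ω hω ↦ (hAN hω).2
    rwa [setIntegral_const, smul_eq_mul, mul_comm] at this
  have hgt : 0 < ∫ ω in A, (f ω - c) ∂μ := by
    rw [setIntegral_pos_iff_support_of_nonneg_ae]
    · have hsupp : A ⊆ Function.support fun ω ↦ f ω - c :=
        fun ω hω ↦ sub_ne_zero.2 (ne_of_gt (hAP hω).2)
      rw [Set.inter_eq_self_of_subset_right hsupp]
      exact (ENNReal.toReal_pos_iff.1 hA0).1
    · exact ae_restrict_of_forall_mem hA fun ω hω ↦ sub_nonneg.2 (hAP hω).2.le
    · exact (hf.sub (integrable_const c)).integrableOn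
  rw [integral_sub hf.integrableOn (integrable_const c).integrableOn, setIntegral_const,
    smul_eq_mul] at hgt
  rw [hAm.trans hAm'.symm] at hgt
  linarith

/-- If two functions have the same integral over subsets of equal measure of `E` and `E'`, then
the first is a.e. equal on `E` to the average of the second on `E'`. -/
lemma ae_eq_setAverage_of_setIntegral_eq
    (hatomless : ∀ s : Set Ω, MeasurableSet s → 0 < μ s →
      ∃ t ⊆ s, MeasurableSet t ∧ 0 < μ t ∧ μ t < μ s)
    {f f' : Ω → ℝ} (hfm : Measurable f) (hfm' : Measurable f')
    (hf : Integrable f μ) (hf' : Integrable f' μ)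
    {E E' : Set Ω} (hE : MeasurableSet E) (hE' : MeasurableSet E') (hEE' : μ E = μ E')
    (h : ∀ A ⊆ E, ∀ A' ⊆ E', MeasurableSet A → MeasurableSet A' → μ A = μ A' →
      ∫ ω in A, f ω ∂μ = ∫ ω in A', f' ω ∂μ) :
    ∀ᵐ ω ∂μ, ω ∈ E → f ω = ⨍ x in E', f' x ∂μ := by
  have hneg := ae_le_setAverage_of_setIntegral_eq hatomless hfm.neg hfm'.neg hf.neg hf'.neg
    hE hE' hEE' fun A hA A' hA' hm hm' hμ ↦ by
      simpa [integral_neg] using h A hA A' hA' hm hm' hμ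
  filter_upwards [ae_le_setAverage_of_setIntegral_eq hatomless hfm hfm' hf hf' hE hE' hEE' h, hneg]
    with ω h1 h2 hω
  refine (h1 hω).antisymm ?_
  have := h2 hω
  simp only [Pi.neg_apply, average_neg] at this
  linarith

end Atomless

/-- Perturbing a random variable by a constant on a subset of a level set changes its law in a way
that depends only on the law, the level, and the measure of the subset. -/
lemma measure_preimage_perturb_add {Ω : Type*} [MeasurableSpace Ω] {μ : Measure Ω}
    {ζ η : Ω → ℝ} {x ε : ℝ} {A : Set Ω}
    (hA : MeasurableSet A) (hAx : ∀ ω ∈ A, ζ ω = x)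
    (hη : ∀ᵐ ω ∂μ, η ω = ζ ω + ε * A.indicator (fun _ ↦ (1 : ℝ)) ω)
    (S : Set ℝ) :
    μ (η ⁻¹' S) + S.indicator (fun _ ↦ μ A) x =
      μ (ζ ⁻¹' S) + S.indicator (fun _ ↦ μ A) (x + ε) := by
  classical
  have hηS : μ (η ⁻¹' S) =
      μ ((fun ω ↦ ζ ω + ε * A.indicator (fun _ ↦ (1 : ℝ)) ω) ⁻¹' S) := by
    refine measure_congr ?_
    filter_upwards [hη] with ω hω
    exact congrArg (· ∈ S) hω
  have hin : ∀ {y : ℝ} {ζ' : Ω → ℝ}, (∀ ω ∈ A, ζ' ω = y) →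
      μ (ζ' ⁻¹' S ∩ A) = S.indicator (fun _ ↦ μ A) y := by
    intro y ζ' hy
    by_cases hyS : y ∈ S
    · rw [Set.indicator_of_mem hyS, Set.inter_eq_self_of_subset_right]
      intro ω hω
      simpa [hy ω hω] using hyS
    · rw [Set.indicator_of_notMem hyS, ← measure_empty (μ := μ)]
      congr 1
      ext ω
      simp only [Set.mem_inter_iff, Set.mem_preimage, Set.mem_empty_iff_false, iff_false, not_and]
      intro h1 h2
      exact hyS (hy ω h2 ▸ h1)
  have hout : (fun ω ↦ ζ ω + ε * A.indicator (fun _ ↦ (1 : ℝ)) ω) ⁻¹' S \ A = ζ ⁻¹' S \ A := by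
    ext ω
    simp only [Set.mem_sdiff, Set.mem_preimage, and_congr_left_iff]
    intro hω
    simp [hω]
  rw [hηS, ← measure_inter_add_sdiff (_ ⁻¹' S) hA, ← measure_inter_add_sdiff (ζ ⁻¹' S) hA, hout,
    hin (y := x + ε) fun ω hω ↦ by simp [hω, hAx ω hω], hin hAx]
  ring

section LawInvariant

variable {Ω : Type*} [MeasurableSpace Ω] {μ : Measure Ω} [IsProbabilityMeasure μ]

/-- On level sets of random variables with the same law, the gradient of a law-invariant functional
has the same integral over subsets of equal measure. -/
lemma setIntegral_gradient_eq {F : Lp ℝ 2 μ → ℝ}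
    (hlaw : ∀ ζ ζ' : Lp ℝ 2 μ, Measure.map (ζ : Ω → ℝ) μ = Measure.map (ζ' : Ω → ℝ) μ →
      F ζ = F ζ')
    {DF : Lp ℝ 2 μ → Lp ℝ 2 μ}
    (hdiff : ∀ ζ η : Lp ℝ 2 μ,
      Tendsto (fun ε : ℝ => (F (ζ + ε • η) - F ζ) / ε) (𝓝[≠] 0)
        (𝓝 (∫ ω, DF ζ ω * η ω ∂μ)))
    {ζ ζ' : Lp ℝ 2 μ} (h : Measure.map (ζ : Ω → ℝ) μ = Measure.map (ζ' : Ω → ℝ) μ)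
    {x : ℝ} {A A' : Set Ω} (hA : MeasurableSet A) (hA' : MeasurableSet A')
    (hAx : ∀ ω ∈ A, ζ ω = x) (hAx' : ∀ ω ∈ A', ζ' ω = x) (hAA' : μ A = μ A') :
    ∫ ω in A, DF ζ ω ∂μ = ∫ ω in A', DF ζ' ω ∂μ := by
  have hη : ∀ (ξ : Lp ℝ 2 μ) {B : Set Ω} (hB : MeasurableSet B) (ε : ℝ),
      ∀ᵐ ω ∂μ, (ξ + ε • indicatorConstLp 2 hB (measure_ne_top μ B) (1 : ℝ)) ω =
        ξ ω + ε * B.indicator (fun _ ↦ (1 : ℝ)) ω := by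
    intro ξ B hB ε
    filter_upwards [Lp.coeFn_add ξ (ε • indicatorConstLp 2 hB (measure_ne_top μ B) (1 : ℝ)),
      Lp.coeFn_smul ε (indicatorConstLp 2 hB (measure_ne_top μ B) (1 : ℝ)),
      indicatorConstLp_coeFn (p := 2) (hs := hB) (hμs := measure_ne_top μ B) (c := (1 : ℝ))]
      with ω h1 h2 h3
    rw [h1, Pi.add_apply, h2, Pi.smul_apply, h3, smul_eq_mul]
  have hint : ∀ (f : Ω → ℝ) {B : Set Ω} (hB : MeasurableSet B),
      ∫ ω, f ω * indicatorConstLp 2 hB (measure_ne_top μ B) (1 : ℝ) ω ∂μ = ∫ ω in B, f ω ∂μ := by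
    intro f B hB
    rw [← integral_indicator hB]
    refine integral_congr_ae ?_
    filter_upwards [indicatorConstLp_coeFn (p := 2) (hs := hB) (hμs := measure_ne_top μ B)
      (c := (1 : ℝ))] with ω hω
    by_cases hωB : ω ∈ B <;> simp [hω, hωB]
  rw [← hint _ hA, ← hint _ hA']
  refine tendsto_nhds_unique (hdiff ζ _) ((hdiff ζ' _).congr fun ε ↦ ?_)
  rw [hlaw ζ ζ' h]
  congr 2
  refine hlaw _ _ (Measure.ext fun S hS ↦ ?_)
  have hm : ∀ ξ : Lp ℝ 2 μ, Measurable ξ := fun ξ ↦ (Lp.stronglyMeasurable ξ).measurable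
  rw [Measure.map_apply (hm _) hS, Measure.map_apply (hm _) hS]
  have e1 := measure_preimage_perturb_add hA hAx (hη ζ hA ε) S
  have e2 := measure_preimage_perturb_add hA' hAx' (hη ζ' hA' ε) S
  have e3 : μ (ζ ⁻¹' S) = μ (ζ' ⁻¹' S) := by
    rw [← Measure.map_apply (hm ζ) hS, h, Measure.map_apply (hm ζ') hS]
  rw [e3, hAA', ← e2] at e1
  refine ((ENNReal.add_left_inj ?_).1 e1).symm
  by_cases hx : x ∈ S <;> simp [hx]

/-- For simple random variables with the same law, one measurable function represents both
gradients. -/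
lemma exists_gradient_eq_comp_of_simple
    (hatomless : ∀ s : Set Ω, MeasurableSet s → 0 < μ s →
      ∃ t ⊆ s, MeasurableSet t ∧ 0 < μ t ∧ μ t < μ s)
    {F : Lp ℝ 2 μ → ℝ}
    (hlaw : ∀ ζ ζ' : Lp ℝ 2 μ, Measure.map (ζ : Ω → ℝ) μ = Measure.map (ζ' : Ω → ℝ) μ →
      F ζ = F ζ')
    {DF : Lp ℝ 2 μ → Lp ℝ 2 μ}
    (hdiff : ∀ ζ η : Lp ℝ 2 μ,
      Tendsto (fun ε : ℝ => (F (ζ + ε • η) - F ζ) / ε) (𝓝[≠] 0)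
        (𝓝 (∫ ω, DF ζ ω * η ω ∂μ)))
    {ζ ζ' : Lp ℝ 2 μ} (h : Measure.map (ζ : Ω → ℝ) μ = Measure.map (ζ' : Ω → ℝ) μ)
    {s : Set ℝ} (hs : s.Finite) (hζs : ∀ᵐ ω ∂μ, ζ ω ∈ s) (hζs' : ∀ᵐ ω ∂μ, ζ' ω ∈ s) :
    ∃ c : ℝ → ℝ, (∀ᵐ ω ∂μ, DF ζ ω = c (ζ ω)) ∧ ∀ᵐ ω ∂μ, DF ζ' ω = c (ζ' ω) := by
  have hm : ∀ ξ : Lp ℝ 2 μ, Measurable ξ := fun ξ ↦ (Lp.stronglyMeasurable ξ).measurable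
  have hi : ∀ ξ : Lp ℝ 2 μ, Integrable ξ μ := fun ξ ↦ (Lp.memLp ξ).integrable one_le_two
  have level : ∀ {χ : Lp ℝ 2 μ}, Measure.map (χ : Ω → ℝ) μ = Measure.map (ζ' : Ω → ℝ) μ →
      (∀ᵐ ω ∂μ, χ ω ∈ s) → ∀ᵐ ω ∂μ, DF χ ω = ⨍ y in ζ' ⁻¹' {χ ω}, DF ζ' y ∂μ := by
    intro χ hχ hχs
    have hall : ∀ᵐ ω ∂μ, ∀ x ∈ s, ω ∈ χ ⁻¹' {x} → DF χ ω = ⨍ y in ζ' ⁻¹' {x}, DF ζ' y ∂μ := by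
      refine (ae_ball_iff hs.countable).2 fun x _ ↦ ?_
      refine ae_eq_setAverage_of_setIntegral_eq hatomless (hm _) (hm _) (hi _) (hi _)
        (hm χ (measurableSet_singleton x)) (hm ζ' (measurableSet_singleton x)) ?_ ?_
      · rw [← Measure.map_apply (hm _) (measurableSet_singleton x), hχ,
          Measure.map_apply (hm _) (measurableSet_singleton x)]
      · exact fun A hAE A' hAE' hA hA' hAA' ↦
          setIntegral_gradient_eq hlaw hdiff hχ hA hA' (fun ω hω ↦ hAE hω) (fun ω hω ↦ hAE' hω) hAA'
    filter_upwards [hall, hχs] with ω h1 h2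
    exact h1 _ h2 rfl
  exact ⟨fun x ↦ ⨍ y in ζ' ⁻¹' {x}, DF ζ' y ∂μ, level h hζs, level rfl hζs'⟩

end LawInvariant

/-- The function `g` in the representation `DF(ξ) = g(ξ)` depends only on the law of `ξ`:
if `ξ` and `ξ'` have the same law, one single Borel function `g` represents both gradients. -/
theorem wasserstein_derivative_law_invariance
    {Ω : Type*} [MeasurableSpace Ω] (μ : Measure Ω) [IsProbabilityMeasure μ]
    (hatomless : ∀ s : Set Ω, MeasurableSet s → 0 < μ s →
      ∃ t ⊆ s, MeasurableSet t ∧ 0 < μ t ∧ μ t < μ s)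
    (F : Lp ℝ 2 μ → ℝ)
    (hlaw : ∀ ζ ζ' : Lp ℝ 2 μ, Measure.map (ζ : Ω → ℝ) μ = Measure.map (ζ' : Ω → ℝ) μ →
      F ζ = F ζ')
    (DF : Lp ℝ 2 μ → Lp ℝ 2 μ)
    (hdiff : ∀ ζ η : Lp ℝ 2 μ,
      Tendsto (fun ε : ℝ => (F (ζ + ε • η) - F ζ) / ε) (𝓝[≠] 0)
        (𝓝 (∫ ω, DF ζ ω * η ω ∂μ)))
    (hcont : Continuous DF)
    (ξ ξ' : Lp ℝ 2 μ)
    (hsamelaw : Measure.map (ξ : Ω → ℝ) μ = Measure.map (ξ' : Ω → ℝ) μ) :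
    ∃ g : ℝ → ℝ, Measurable g ∧ (∀ᵐ ω ∂μ, DF ξ ω = g (ξ ω)) ∧
      (∀ᵐ ω ∂μ, DF ξ' ω = g (ξ' ω)) := by
  have hm : ∀ ζ : Lp ℝ 2 μ, Measurable ζ := fun ζ ↦ (Lp.stronglyMeasurable ζ).measurable
  set ν := Measure.map (ξ : Ω → ℝ) μ with hν
  have hξ : MeasurePreserving ξ μ ν := ⟨hm ξ, rfl⟩
  have hξ' : MeasurePreserving ξ' μ ν := ⟨hm ξ', hsamelaw.symm⟩
  let C : Lp ℝ 2 ν → Lp ℝ 2 μ := Lp.compMeasurePreserving ξ hξ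
  let C' : Lp ℝ 2 ν → Lp ℝ 2 μ := Lp.compMeasurePreserving ξ' hξ'
  have hC : Isometry C := Lp.isometry_compMeasurePreserving hξ
  have hC' : Isometry C' := Lp.isometry_compMeasurePreserving hξ'
  have hpair : Isometry fun f ↦ (C f, C' f) := fun f g ↦ by
    simp [Prod.edist_eq, hC f g, hC' f g]
  have hclosed : IsClosed {f : Lp ℝ 2 ν | (DF (C f), DF (C' f)) ∈ Set.range fun f ↦ (C f, C' f)} :=
    hpair.isClosedEmbedding.isClosed_range.preimage
      ((hcont.comp hC.continuous).prodMk (hcont.comp hC'.continuous))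
  have hcoe : ∀ f : Lp ℝ 2 ν, (∀ᵐ ω ∂μ, C f ω = f (ξ ω)) ∧ ∀ᵐ ω ∂μ, C' f ω = f (ξ' ω) :=
    fun f ↦ ⟨Lp.coeFn_compMeasurePreserving f hξ, Lp.coeFn_compMeasurePreserving f hξ'⟩
  have hmap : ∀ f : Lp ℝ 2 ν, Measure.map (C f) μ = Measure.map (C' f) μ := by
    intro f
    have hf : Measurable f := (Lp.stronglyMeasurable f).measurable
    rw [Measure.map_congr (hcoe f).1, Measure.map_congr (hcoe f).2]
    change Measure.map (f ∘ ξ) μ = Measure.map (f ∘ ξ') μ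
    rw [← Measure.map_map hf (hm ξ), ← Measure.map_map hf (hm ξ'), ← hsamelaw]
  have hall : ∀ f : Lp ℝ 2 ν, (DF (C f), DF (C' f)) ∈ Set.range fun f ↦ (C f, C' f) := by
    intro f
    refine (Lp.simpleFunc.denseRange (by norm_num : (2 : ℝ≥0∞) ≠ ∞)).induction_on f hclosed ?_
    intro φ
    let σ := Lp.simpleFunc.toSimpleFunc φ
    have hσ : σ =ᵐ[ν] (φ : Lp ℝ 2 ν) := Lp.simpleFunc.toSimpleFunc_eq_toFun φ
    have hφ : ∀ᵐ ω ∂μ, C φ ω = σ (ξ ω) := by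
      filter_upwards [(hcoe φ).1, hξ.quasiMeasurePreserving.ae hσ] with ω h1 h2
      rw [h1, h2]
    have hφ' : ∀ᵐ ω ∂μ, C' φ ω = σ (ξ' ω) := by
      filter_upwards [(hcoe φ).2, hξ'.quasiMeasurePreserving.ae hσ] with ω h1 h2
      rw [h1, h2]
    obtain ⟨c, hc, hc'⟩ := exists_gradient_eq_comp_of_simple hatomless hlaw hdiff (hmap φ)
      σ.finite_range (hφ.mono fun ω h ↦ h ▸ Set.mem_range_self _)
      (hφ'.mono fun ω h ↦ h ▸ Set.mem_range_self _)
    have hL : MemLp (σ.map c) 2 ν := (σ.map c).memLp_of_isFiniteMeasure 2 ν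
    refine ⟨hL.toLp _, Prod.ext (Lp.ext ?_) (Lp.ext ?_)⟩
    · filter_upwards [(hcoe (hL.toLp _)).1, hξ.quasiMeasurePreserving.ae hL.coeFn_toLp, hφ, hc]
        with ω h1 h2 h3 h4
      rw [h1, h2, h4, h3, SimpleFunc.map_apply]
    · filter_upwards [(hcoe (hL.toLp _)).2, hξ'.quasiMeasurePreserving.ae hL.coeFn_toLp, hφ', hc']
        with ω h1 h2 h3 h4
      rw [h1, h2, h4, h3, SimpleFunc.map_apply]
  have hid : MemLp id 2 ν :=
    (memLp_map_measure_iff aestronglyMeasurable_id (hm ξ).aemeasurable).2 (Lp.memLp ξ)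
  have hCid : C (hid.toLp id) = ξ := Lp.ext <| by
    filter_upwards [(hcoe (hid.toLp id)).1, hξ.quasiMeasurePreserving.ae hid.coeFn_toLp]
      with ω h1 h2
    rw [h1, h2, id]
  have hCid' : C' (hid.toLp id) = ξ' := Lp.ext <| by
    filter_upwards [(hcoe (hid.toLp id)).2, hξ'.quasiMeasurePreserving.ae hid.coeFn_toLp]
      with ω h1 h2
    rw [h1, h2, id]
  obtain ⟨g, hg⟩ := hall (hid.toLp id)
  rw [hCid, hCid', Prod.mk.injEq] at hg
  refine ⟨g, (Lp.stronglyMeasurable g).measurable, ?_, ?_⟩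
  · rw [← hg.1]
    exact (hcoe g).1
  · rw [← hg.2]
    exact (hcoe g).2
end
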